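/- Under the Gaussian box-decomposition setup, for every m, the restricted standardized second moment satisfies ∫ (ȳ m)²·1_{f ∈ D} dP = W − (ρ m)² · Σ_{j=1}^J (W[j]/W[j,m]) · V[j,m]. -/

import Mathlib

open MeasureTheory ProbabilityTheory

noncomputable section

/-- The density of the standard normal distribution. -/
def stdPdf (z : ℝ) : ℝ := (Real.sqrt (2 * Real.pi))⁻¹ * Real.exp (-z ^ 2 / 2)

/-- The cumulative distribution function of the standard normal distribution. -/
def stdCdf (x : ℝ) : ℝ := ∫ z in Set.Iic x, stdPdf z

/-- The standardization map `γ m c = (c − μ m)/√(s m)`. -/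
def gam {M : ℕ} (μ s : Fin M → ℝ) (m : Fin M) (c : ℝ) : ℝ :=
  (c - μ m) / Real.sqrt (s m)

/-- `W[j,m] = Φ(γ m (u j m)) − Φ(γ m (l j m))`. -/
def Wjm {M J : ℕ} (μ s : Fin M → ℝ) (l u : Fin J → Fin M → ℝ) (j : Fin J) (m : Fin M) : ℝ :=
  stdCdf (gam μ s m (u j m)) - stdCdf (gam μ s m (l j m))

/-- `W[j] = ∏_m W[j,m]`. -/
def Wj {M J : ℕ} (μ s : Fin M → ℝ) (l u : Fin J → Fin M → ℝ) (j : Fin J) : ℝ :=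
  ∏ m, Wjm μ s l u j m

/-- `W = Σ_j W[j]`. -/
def Wtot {M J : ℕ} (μ s : Fin M → ℝ) (l u : Fin J → Fin M → ℝ) : ℝ :=
  ∑ j, Wj μ s l u j

/-- `G[j,m] = φ(γ m (u j m)) − φ(γ m (l j m))`. -/
def Gjm {M J : ℕ} (μ s : Fin M → ℝ) (l u : Fin J → Fin M → ℝ) (j : Fin J) (m : Fin M) : ℝ :=
  stdPdf (gam μ s m (u j m)) - stdPdf (gam μ s m (l j m))

/-- `V[j,m] = γ m (u j m)·φ(γ m (u j m)) − γ m (l j m)·φ(γ m (l j m))`. -/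
def Vjm {M J : ℕ} (μ s : Fin M → ℝ) (l u : Fin J → Fin M → ℝ) (j : Fin J) (m : Fin M) : ℝ :=
  gam μ s m (u j m) * stdPdf (gam μ s m (u j m))
    - gam μ s m (l j m) * stdPdf (gam μ s m (l j m))

/-- `ρ m = √(s m / (s m + σ m))`. -/
def rho {M : ℕ} (s σ : Fin M → ℝ) (m : Fin M) : ℝ := Real.sqrt (s m / (s m + σ m))

/-- The union `D = ⋃_j B j` of the boxes `B j`. -/
def boxD {M J : ℕ} (l u : Fin J → Fin M → ℝ) : Set (Fin M → ℝ) :=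
  ⋃ j, {z : Fin M → ℝ | ∀ m, l j m < z m ∧ z m ≤ u j m}

/-- The joint law of `(f, ε)`: the product of the two product Gaussian measures
`⨂_m N(μ m, s m)` and `⨂_m N(0, σ m)`. -/
def Pmeas {M : ℕ} (μ s σ : Fin M → ℝ) : Measure ((Fin M → ℝ) × (Fin M → ℝ)) :=
  (Measure.pi fun m => gaussianReal (μ m) (s m).toNNReal).prod
    (Measure.pi fun m => gaussianReal 0 (σ m).toNNReal)

end

theorem stdPdf_pos (z : ℝ) : 0 < stdPdf z := by
  unfold stdPdf
  positivity

theorem continuous_stdPdf : Continuous stdPdf := by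
  unfold stdPdf
  fun_prop

theorem stdPdf_eq_gaussianPDFReal : stdPdf = gaussianPDFReal 0 1 := by
  ext z
  simp [stdPdf, gaussianPDFReal]

theorem hasDerivAt_stdPdf (z : ℝ) : HasDerivAt stdPdf (-z * stdPdf z) z := by
  have h : HasDerivAt (fun x : ℝ => -x ^ 2 / 2) (-z) z := by
    refine (((hasDerivAt_id z).pow 2).neg.div_const 2).congr_deriv ?_
    simp only [id, Nat.cast_ofNat]
    ring
  refine (h.exp.const_mul _).congr_deriv ?_
  unfold stdPdf
  ring

theorem stdCdf_sub_stdCdf (a b : ℝ) : stdCdf b - stdCdf a = ∫ z in a..b, stdPdf z := by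
  have h : Integrable stdPdf := by
    rw [stdPdf_eq_gaussianPDFReal]
    exact integrable_gaussianPDFReal 0 1
  exact intervalIntegral.integral_Iic_sub_Iic h.integrableOn h.integrableOn

theorem integral_sq_mul_stdPdf (a b : ℝ) :
    ∫ z in a..b, z ^ 2 * stdPdf z
      = (stdCdf b - stdCdf a) - (b * stdPdf b - a * stdPdf a) := by
  have hd (z : ℝ) : HasDerivAt (fun x => x * stdPdf x) (stdPdf z - z ^ 2 * stdPdf z) z := by
    refine ((hasDerivAt_id z).mul (hasDerivAt_stdPdf z)).congr_deriv ?_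
    simp only [id]
    ring
  have hc := continuous_stdPdf
  have hc' : Continuous fun z => z ^ 2 * stdPdf z := by fun_prop
  rw [stdCdf_sub_stdCdf,
    ← intervalIntegral.integral_eq_sub_of_hasDerivAt (fun z _ => hd z)
      ((hc.sub hc').intervalIntegrable a b),
    intervalIntegral.integral_sub (hc.intervalIntegrable a b) (hc'.intervalIntegrable a b)]
  ring

/-- Integration of `g` over an interval against a Gaussian measure, in standardized coordinates. -/
theorem integral_mul_indicator_Ioc_gaussianReal (μ : ℝ) {v : ℝ} (hv : 0 < v) (g : ℝ → ℝ)
    {a b : ℝ} (hab : a ≤ b) :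
    ∫ x, g x * (Set.Ioc a b).indicator (fun _ => (1 : ℝ)) x ∂gaussianReal μ v.toNNReal
      = ∫ z in ((a - μ) / Real.sqrt v)..((b - μ) / Real.sqrt v),
          g (Real.sqrt v * z + μ) * stdPdf z := by
  have hsv : 0 < Real.sqrt v := Real.sqrt_pos.2 hv
  have hpdf (z : ℝ) : Real.sqrt v * gaussianPDFReal μ v.toNNReal (Real.sqrt v * z + μ)
      = stdPdf z := by
    simp only [gaussianPDFReal, stdPdf, Real.coe_toNNReal v hv.le, add_sub_cancel_right, mul_pow,
      Real.sq_sqrt hv.le]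
    rw [Real.sqrt_mul (by positivity), mul_inv, show -(v * z ^ 2) / (2 * v) = -z ^ 2 / 2 by
      field_simp]
    field_simp
  have hend (c : ℝ) : Real.sqrt v * ((c - μ) / Real.sqrt v) + μ = c := by
    field_simp
    ring
  rw [integral_gaussianReal_eq_integral_smul (Real.toNNReal_pos.2 hv).ne']
  have hind : (fun x => gaussianPDFReal μ v.toNNReal x •
      (g x * (Set.Ioc a b).indicator (fun _ => (1 : ℝ)) x))
      = (Set.Ioc a b).indicator fun x => gaussianPDFReal μ v.toNNReal x * g x := by
    ext x
    by_cases hx : x ∈ Set.Ioc a b <;> simp [hx]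
  rw [hind, integral_indicator measurableSet_Ioc, ← intervalIntegral.integral_of_le hab]
  have hsub := intervalIntegral.mul_integral_comp_mul_add
    (a := (a - μ) / Real.sqrt v) (b := (b - μ) / Real.sqrt v)
    (f := fun x => gaussianPDFReal μ v.toNNReal x * g x) (c := Real.sqrt v) (d := μ)
  rw [hend, hend] at hsub
  rw [← hsub, ← intervalIntegral.integral_const_mul]
  refine intervalIntegral.integral_congr fun z _ => ?_
  simp only [← hpdf z]
  ring

/-- Integral over a box of a function of one coordinate against a product measure. -/
theorem integral_eval_mul_indicator_pi {ι : Type*} [Fintype ι] [DecidableEq ι]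
    (ν : ι → Measure ℝ) [∀ i, SigmaFinite (ν i)] (t : ι → Set ℝ) (i : ι) (g : ℝ → ℝ) :
    ∫ z, g (z i) * (Set.univ.pi t).indicator (fun _ => (1 : ℝ)) z ∂Measure.pi ν
      = (∫ x, g x * (t i).indicator (fun _ => (1 : ℝ)) x ∂ν i)
        * ∏ k ∈ Finset.univ.erase i, ∫ x, (t k).indicator (fun _ => (1 : ℝ)) x ∂ν k := by
  have hfun (z : ι → ℝ) : g (z i) * (Set.univ.pi t).indicator (fun _ => (1 : ℝ)) z
      = ∏ k, (if k = i then g (z k) else 1) * (t k).indicator (fun _ => (1 : ℝ)) (z k) := by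
    rw [Finset.prod_mul_distrib, Finset.prod_ite_eq' Finset.univ i fun k => g (z k)]
    simp only [Finset.mem_univ, if_true]
    congr 1
    by_cases hz : z ∈ Set.univ.pi t
    · rw [Set.indicator_of_mem hz]
      exact (Finset.prod_eq_one fun k _ => Set.indicator_of_mem (hz k trivial) _).symm
    · rw [Set.indicator_of_notMem hz]
      obtain ⟨k, hk⟩ : ∃ k, z k ∉ t k := by simpa [Set.mem_pi] using hz
      exact (Finset.prod_eq_zero (Finset.mem_univ k) (Set.indicator_of_notMem hk _)).symm
  simp_rw [hfun]
  rw [integral_fintype_prod_eq_prod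
    (fun k x => (if k = i then g x else 1) * (t k).indicator (fun _ => (1 : ℝ)) x),
    ← Finset.mul_prod_erase _ _ (Finset.mem_univ i)]
  congr 1
  · simp
  · refine Finset.prod_congr rfl fun k hk => ?_
    simp [Finset.ne_of_mem_erase hk]

theorem integral_sq_gaussianReal_zero (v : NNReal) : ∫ x, x ^ 2 ∂gaussianReal 0 v = v := by
  rw [← variance_fun_id_gaussianReal (μ := 0) (v := v),
    variance_of_integral_eq_zero (by fun_prop) (by simp)]

theorem Wjm_pos {M J : ℕ} {μ s : Fin M → ℝ} (hs : ∀ m, 0 < s m) {l u : Fin J → Fin M → ℝ}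
    (hlu : ∀ j m, l j m < u j m) (j : Fin J) (m : Fin M) : 0 < Wjm μ s l u j m := by
  rw [Wjm, stdCdf_sub_stdCdf]
  refine intervalIntegral.intervalIntegral_pos_of_pos
    (continuous_stdPdf.intervalIntegrable _ _) stdPdf_pos ?_
  exact div_lt_div_of_pos_right (sub_lt_sub_right (hlu j m) _) (Real.sqrt_pos.2 (hs m))

/-- For a random vector with independent centred noise, the restricted second moment of a noisy
coordinate splits into the signal part and the noise part. -/
theorem integral_add_sq_mul_prod {α β : Type*} [MeasurableSpace α] [MeasurableSpace β]
    (P : Measure α) (Q : Measure β) [SFinite P] [IsProbabilityMeasure Q]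
    {X I : α → ℝ} {Y : β → ℝ} (hI : Integrable I P) (hXI : Integrable (fun a => X a * I a) P)
    (hX2I : Integrable (fun a => X a ^ 2 * I a) P)
    (hY : MemLp Y 2 Q) (hY0 : ∫ b, Y b ∂Q = 0) :
    Integrable (fun p : α × β => (X p.1 + Y p.2) ^ 2 * I p.1) (P.prod Q) ∧
    ∫ p : α × β, (X p.1 + Y p.2) ^ 2 * I p.1 ∂(P.prod Q)
      = (∫ a, X a ^ 2 * I a ∂P) + (∫ b, Y b ^ 2 ∂Q) * ∫ a, I a ∂P := by
  have hfun : (fun p : α × β => (X p.1 + Y p.2) ^ 2 * I p.1)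
      = ((fun p => X p.1 ^ 2 * I p.1 * 1) + fun p => X p.1 * I p.1 * (2 * Y p.2))
        + fun p => I p.1 * Y p.2 ^ 2 := by
    ext p
    simp only [Pi.add_apply]
    ring
  have h1 := hX2I.mul_prod (integrable_const (μ := Q) (1 : ℝ))
  have h2 := hXI.mul_prod ((hY.integrable (by norm_num)).const_mul 2)
  have h3 := hI.mul_prod hY.integrable_sq
  rw [hfun]
  refine ⟨(h1.add h2).add h3, ?_⟩
  rw [integral_add' (h1.add h2) h3, integral_add' h1 h2,
    integral_prod_mul (fun a => X a ^ 2 * I a) fun _ => (1 : ℝ),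
    integral_prod_mul (fun a => X a * I a) fun b => 2 * Y b,
    integral_prod_mul I fun b => Y b ^ 2, integral_const_mul, hY0]
  simp [mul_comm]

/-- The restricted second moment over a single box. -/
theorem integral_sq_mul_indicator_box {M J : ℕ} (μ s σ : Fin M → ℝ) (hs : ∀ m, 0 < s m)
    (hσ : ∀ m, 0 ≤ σ m) (l u : Fin J → Fin M → ℝ) (hlu : ∀ j m, l j m < u j m)
    (j : Fin J) (m : Fin M) :
    Integrable (fun p : (Fin M → ℝ) × (Fin M → ℝ) => (p.1 m - μ m + p.2 m) ^ 2
        * (Set.univ.pi fun k => Set.Ioc (l j k) (u j k)).indicator (fun _ => (1 : ℝ)) p.1)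
      (Pmeas μ s σ) ∧
    ∫ p, (p.1 m - μ m + p.2 m) ^ 2
        * (Set.univ.pi fun k => Set.Ioc (l j k) (u j k)).indicator (fun _ => (1 : ℝ)) p.1
        ∂(Pmeas μ s σ)
      = (s m + σ m) * Wj μ s l u j - s m * (Wj μ s l u j / Wjm μ s l u j m * Vjm μ s l u j m) := by
  set ν : Fin M → Measure ℝ := fun m => gaussianReal (μ m) (s m).toNNReal
  set η : Fin M → Measure ℝ := fun m => gaussianReal 0 (σ m).toNNReal
  set t : Fin M → Set ℝ := fun k => Set.Ioc (l j k) (u j k)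
  have ht : MeasurableSet (Set.univ.pi t) :=
    MeasurableSet.univ_pi fun _ => measurableSet_Ioc
  have hint {g : (Fin M → ℝ) → ℝ} (hg : Integrable g (Measure.pi ν)) :
      Integrable (fun z => g z * (Set.univ.pi t).indicator (fun _ => (1 : ℝ)) z)
        (Measure.pi ν) := by
    refine (hg.indicator ht).congr (.of_forall fun z => ?_)
    by_cases hz : z ∈ Set.univ.pi t <;> simp [hz]
  have hX : MemLp (fun z : Fin M → ℝ => z m - μ m) 2 (Measure.pi ν) :=
    (((memLp_id_gaussianReal 2).comp_measurePreserving (measurePreserving_eval ν m)).sub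
      (memLp_const (μ m)))
  have hY : MemLp (fun z : Fin M → ℝ => z m) 2 (Measure.pi η) :=
    (memLp_id_gaussianReal 2).comp_measurePreserving (measurePreserving_eval η m)
  have hY0 : ∫ z : Fin M → ℝ, z m ∂Measure.pi η = 0 := by
    rw [integral_comp_eval (μ := η) (i := m) (f := fun x : ℝ => x) (by fun_prop)]
    exact integral_id_gaussianReal
  have hY2 : ∫ z : Fin M → ℝ, z m ^ 2 ∂Measure.pi η = σ m := by
    rw [integral_comp_eval (μ := η) (i := m) (f := fun x : ℝ => x ^ 2) (by fun_prop)]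
    simp only [η, integral_sq_gaussianReal_zero, Real.coe_toNNReal _ (hσ m)]
  have hW (k : Fin M) : ∫ x, (t k).indicator (fun _ => (1 : ℝ)) x ∂ν k = Wjm μ s l u j k := by
    simpa [Wjm, gam, stdCdf_sub_stdCdf, t, ν] using
      integral_mul_indicator_Ioc_gaussianReal (μ k) (hs k) (fun _ => 1) (hlu j k).le
  have hQ : ∫ x, (x - μ m) ^ 2 * (t m).indicator (fun _ => (1 : ℝ)) x ∂ν m
      = s m * (Wjm μ s l u j m - Vjm μ s l u j m) := by
    rw [integral_mul_indicator_Ioc_gaussianReal (μ m) (hs m) (fun x => (x - μ m) ^ 2)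
      (hlu j m).le]
    simp only [add_sub_cancel_right, mul_pow, Real.sq_sqrt (hs m).le, mul_assoc]
    rw [intervalIntegral.integral_const_mul, integral_sq_mul_stdPdf]
    rfl
  have hprod : Wjm μ s l u j m * ∏ k ∈ Finset.univ.erase m, Wjm μ s l u j k = Wj μ s l u j :=
    Finset.mul_prod_erase _ _ (Finset.mem_univ m)
  have hI0 := integral_eval_mul_indicator_pi ν t m fun _ => 1
  have hI2 := integral_eval_mul_indicator_pi ν t m fun x => (x - μ m) ^ 2
  simp only [one_mul, hW, hQ] at hI0 hI2
  obtain ⟨hi, he⟩ := integral_add_sq_mul_prod (Measure.pi ν) (Measure.pi η)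
    (by simpa using hint (integrable_const (1 : ℝ))) (hint (hX.integrable (by norm_num)))
    (hint hX.integrable_sq) hY hY0
  refine ⟨hi, he.trans ?_⟩
  have hpos := (Wjm_pos (μ := μ) hs hlu j m).ne'
  rw [hI0, hI2, hY2, ← hprod]
  field_simp
  ring

theorem indicator_boxD {M J : ℕ} {l u : Fin J → Fin M → ℝ}
    (hdisj : Pairwise fun j j' : Fin J => Disjoint
        {z : Fin M → ℝ | ∀ m, l j m < z m ∧ z m ≤ u j m}
        {z : Fin M → ℝ | ∀ m, l j' m < z m ∧ z m ≤ u j' m}) (z : Fin M → ℝ) :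
    (boxD l u).indicator (fun _ => (1 : ℝ)) z
      = ∑ j, (Set.univ.pi fun k => Set.Ioc (l j k) (u j k)).indicator (fun _ => (1 : ℝ)) z := by
  have hbox (j : Fin J) : (Set.univ.pi fun k => Set.Ioc (l j k) (u j k))
      = {z : Fin M → ℝ | ∀ m, l j m < z m ∧ z m ≤ u j m} := by
    ext z
    simp [Set.mem_pi]
  simp only [hbox]
  by_cases hz : z ∈ boxD l u
  · obtain ⟨j, hj⟩ := Set.mem_iUnion.1 hz
    rw [Set.indicator_of_mem hz, Finset.sum_eq_single j, Set.indicator_of_mem hj]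
    · exact fun i _ hij =>
        Set.indicator_of_notMem (fun hi => Set.disjoint_left.1 (hdisj hij) hi hj) _
    · simp
  · rw [Set.indicator_of_notMem hz]
    exact (Finset.sum_eq_zero fun j _ =>
      Set.indicator_of_notMem (fun hj => hz (Set.mem_iUnion.2 ⟨j, hj⟩)) _).symm

/-- Restricted standardized second moment. -/
theorem restricted_standardized_second_moment
    (M J : ℕ) (hM : 1 ≤ M) (hJ : 1 ≤ J)
    (μ s σ : Fin M → ℝ) (hs : ∀ m, 0 < s m) (hσ : ∀ m, 0 ≤ σ m)
    (l u : Fin J → Fin M → ℝ) (hlu : ∀ j m, l j m < u j m)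
    (hdisj : Pairwise fun j j' : Fin J => Disjoint
        {z : Fin M → ℝ | ∀ m, l j m < z m ∧ z m ≤ u j m}
        {z : Fin M → ℝ | ∀ m, l j' m < z m ∧ z m ≤ u j' m})
    (m : Fin M) :
    ∫ p, ((p.1 m + p.2 m - μ m) / Real.sqrt (s m + σ m)) ^ 2
        * Set.indicator (boxD l u) (fun _ => (1 : ℝ)) p.1 ∂(Pmeas μ s σ)
      = Wtot μ s l u - rho s σ m ^ 2
          * ∑ j, (Wj μ s l u j / Wjm μ s l u j m) * Vjm μ s l u j m := by
  have hpos : 0 < s m + σ m := add_pos_of_pos_of_nonneg (hs m) (hσ m)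
  have hbox := fun j => integral_sq_mul_indicator_box μ s σ hs hσ l u hlu j m
  have hfun (p : (Fin M → ℝ) × (Fin M → ℝ)) :
      ((p.1 m + p.2 m - μ m) / Real.sqrt (s m + σ m)) ^ 2
        * Set.indicator (boxD l u) (fun _ => (1 : ℝ)) p.1
      = (s m + σ m)⁻¹ * ∑ j, (p.1 m - μ m + p.2 m) ^ 2
        * (Set.univ.pi fun k => Set.Ioc (l j k) (u j k)).indicator (fun _ => (1 : ℝ)) p.1 := by
    rw [indicator_boxD hdisj, div_pow, Real.sq_sqrt hpos.le, ← Finset.mul_sum]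
    ring
  simp_rw [hfun]
  rw [integral_const_mul, integral_finsetSum _ fun j _ => (hbox j).1,
    Finset.sum_congr rfl fun j _ => (hbox j).2, Finset.sum_sub_distrib, ← Finset.mul_sum,
    ← Finset.mul_sum, rho, Real.sq_sqrt (div_nonneg (hs m).le hpos.le), Wtot]
  field_simp
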